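/- arXiv:2202.12111 — 2 statements merged into one kernel-verified Lean document; each statement's English description precedes it below -/
import Mathlib

section
/- Let q be an odd prime and let C be a linear [n,k]_q code with parity check matrix H, with h = h_H the indicator function of the columns of Ĥ and ĥ its Vilenkin–Chrestenson transform. Let e_1, …, e_θ, with θ = (q^{n−k}−1)/(q−1), be a maximal set of pairwise non-proportional nonzero vectors in (ZMod q)^{n−k} (i.e., no e_i is a scalar multiple of e_j for i ≠ j, and every nonzero vector of (ZMod q)^{n−k} is a nonzero scalar multiple of some e_i). Then the covering radius ρ(C) equals the smallest natural number j such that the Vilenkin–Chrestenson transform of ĥ^j is nonzero at e_i for every i = 1, …, θ. -/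
open Classical

/-- The Vilenkin–Chrestenson transform of a function `h : (ZMod q)^s → ℂ` with respect to a
complex number `ξ` (intended: a primitive `q`-th root of unity):
`ĥ(ω) = Σ_x h(x) ξ^{ω·x}`, the exponent being the integer representative of `ω·x ∈ ZMod q`. -/
noncomputable def vcTransform (q s : ℕ) [NeZero q] (ξ : ℂ)
    (h : (Fin s → ZMod q) → ℂ) : (Fin s → ZMod q) → ℂ :=
  fun ω => ∑ x : Fin s → ZMod q, h x * ξ ^ (∑ i, ω i * x i).val

/-- The covering radius of a code `C` (a set of words of length `n` over `F`): the smallest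
`s` such that every word is within Hamming distance `s` of some codeword. -/
noncomputable def coveringRadius {n : ℕ} {F : Type*} [DecidableEq F]
    (C : Set (Fin n → F)) : ℕ :=
  sInf {s : ℕ | ∀ v : Fin n → F, ∃ c ∈ C, hammingDist v c ≤ s}

/-- The characteristic (indicator) function of the columns of
`Ĥ = (H | α₂H | … | α_{q-1}H)`, i.e. of the set of all nonzero scalar multiples of columns
of the parity check matrix `H`. -/
noncomputable def colIndicator {r n : ℕ} {F : Type*} [CommRing F]
    (H : Matrix (Fin r) (Fin n) F) : (Fin r → F) → ℂ :=
  fun y => if ∃ u : F, u ≠ 0 ∧ ∃ j : Fin n, y = u • (fun i => H i j) then 1 else 0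

open scoped Pointwise

/-- Orthogonality: the sum of a primitive `q`-th root of unity over all dot products with `a`. -/
lemma sum_pow_dotProduct_val (q s : ℕ) [Fact q.Prime] {ξ : ℂ} (hξ : IsPrimitiveRoot ξ q)
    (a : Fin s → ZMod q) :
    ∑ x : Fin s → ZMod q, ξ ^ (∑ i, a i * x i).val = if a = 0 then (q : ℂ) ^ s else 0 := by
  split_ifs with ha
  · simp [ha]
  · let χ : AddChar (ZMod q) ℂ := AddChar.zmodChar q hξ.pow_eq_one
    have hχ : χ.IsPrimitive := AddChar.zmodChar_primitive_of_primitive_root q hξ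
    obtain ⟨i, hi⟩ := Function.ne_iff.mp ha
    let f : (Fin s → ZMod q) →+ ZMod q :=
      { toFun := fun x => ∑ i, a i * x i
        map_zero' := by simp
        map_add' := fun x y => by simp [mul_add, Finset.sum_add_distrib] }
    have hne : χ.compAddMonoidHom f ≠ 0 := by
      intro h
      refine hχ hi (DFunLike.ext _ _ fun t => ?_)
      have := DFunLike.congr_fun h (Pi.single i t)
      simpa [f, AddChar.mulShift_apply, Pi.single_apply] using this
    exact AddChar.sum_eq_zero_iff_ne_zero.mpr hne

/-- The transform of the `j`-th power of the transform of an indicator function is nonzero at `ω`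
exactly when `-ω` is a sum of `j` elements of the underlying set. -/
lemma vcTransform_vcTransform_pow_ne_zero_iff (q s : ℕ) [Fact q.Prime] {ξ : ℂ}
    (hξ : IsPrimitiveRoot ξ q) (S : Set (Fin s → ZMod q)) (j : ℕ) (ω : Fin s → ZMod q) :
    vcTransform q s ξ ((vcTransform q s ξ fun y => if y ∈ S then 1 else 0) ^ j) ω ≠ 0 ↔
      -ω ∈ j • S := by
  have hmul (a b : ZMod q) : ξ ^ (a + b).val = ξ ^ a.val * ξ ^ b.val :=
    (AddChar.zmodChar q hξ.pow_eq_one).map_add_eq_mul a b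
  have hsum (f : Fin j → ZMod q) : ξ ^ (∑ i, f i).val = ∏ i, ξ ^ (f i).val :=
    map_prod (AddChar.zmodChar q hξ.pow_eq_one).toMonoidHom
      (fun i => Multiplicative.ofAdd (f i)) Finset.univ
  have key : vcTransform q s ξ ((vcTransform q s ξ fun y => if y ∈ S then 1 else 0) ^ j) ω =
      ∑ p : Fin j → Fin s → ZMod q,
        if (∀ i, p i ∈ S) ∧ ∑ i, p i + ω = 0 then (q : ℂ) ^ s else 0 := by
    simp only [vcTransform, Pi.pow_apply, Fintype.sum_pow, Finset.sum_mul]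
    rw [Finset.sum_comm]
    refine Finset.sum_congr rfl fun p _ => ?_
    have hx (x : Fin s → ZMod q) :
        (∏ l, ((if p l ∈ S then (1 : ℂ) else 0) * ξ ^ (∑ i, x i * p l i).val)) *
            ξ ^ (∑ i, ω i * x i).val =
          (if ∀ l, p l ∈ S then 1 else 0) * ξ ^ (∑ i, (∑ l, p l + ω) i * x i).val := by
      have hdot : ∑ i, (∑ l, p l + ω) i * x i =
          (∑ l, ∑ i, x i * p l i) + ∑ i, ω i * x i := by
        rw [Finset.sum_comm]
        simp [add_mul, Finset.sum_add_distrib, Finset.sum_mul, mul_comm (p _ _)]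
      rw [hdot, hmul, hsum, Finset.prod_mul_distrib, Finset.prod_ite_zero, mul_assoc]
      simp
    rw [Finset.sum_congr rfl fun x _ => hx x, ← Finset.mul_sum, sum_pow_dotProduct_val q s hξ]
    split_ifs <;> simp_all
  have hq : (q : ℂ) ^ s ≠ 0 := pow_ne_zero _ (Nat.cast_ne_zero.mpr (NeZero.ne q))
  rw [key, ← Finset.sum_filter, Finset.sum_const, nsmul_eq_mul, mul_ne_zero_iff,
    and_iff_left hq, Nat.cast_ne_zero, Finset.card_ne_zero, Set.mem_nsmul]
  constructor
  · rintro ⟨p, hp⟩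
    obtain ⟨hp, hω⟩ := (Finset.mem_filter.mp hp).2
    exact ⟨fun i => ⟨p i, hp i⟩, by simpa [List.sum_ofFn] using eq_neg_of_add_eq_zero_left hω⟩
  · rintro ⟨p, hp⟩
    refine ⟨fun i => p i, Finset.mem_filter.mpr ⟨Finset.mem_univ _, fun i => (p i).2, ?_⟩⟩
    rw [List.sum_ofFn] at hp
    simp [hp]

/-- The nonzero scalar multiples of the columns of a matrix. -/
def colMultiples {r n : ℕ} {F : Type*} [CommRing F] (H : Matrix (Fin r) (Fin n) F) :
    Set (Fin r → F) :=
  {y | ∃ u : F, u ≠ 0 ∧ ∃ j : Fin n, y = u • (fun i => H i j)}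

section Syndrome

variable {r n : ℕ} {F : Type*} [Field F] (H : Matrix (Fin r) (Fin n) F)

lemma exists_mulVec_eq_of_mem_nsmul_colMultiples [DecidableEq F] {j : ℕ} {y : Fin r → F}
    (hy : y ∈ j • colMultiples H) : ∃ x, H.mulVec x = y ∧ hammingNorm x ≤ j := by
  induction j generalizing y with
  | zero => exact ⟨0, by simp_all, by simp⟩
  | succ j ih =>
    rw [succ_nsmul] at hy
    obtain ⟨z, hz, _, ⟨u, -, c, rfl⟩, rfl⟩ := Set.mem_add.mp hy
    obtain ⟨x, rfl, hx⟩ := ih hz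
    refine ⟨x + Pi.single c u, ?_, ?_⟩
    · rw [Matrix.mulVec_add, Matrix.mulVec_single]
      ext i
      simp
    · have hsub : (Finset.univ.filter fun i => (x + Pi.single c u : Fin n → F) i ≠ 0) ⊆
          insert c (Finset.univ.filter fun i => x i ≠ 0) := by
        intro i hi
        by_cases hic : i = c <;> simp_all
      exact ((Finset.card_le_card hsub).trans (Finset.card_insert_le _ _)).trans
        (Nat.succ_le_succ hx)

lemma nsmul_colMultiples_subset (h2 : (2 : F) ≠ 0) {m j : ℕ} (hm : m ≠ 0) (hmj : m ≤ j) :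
    m • colMultiples H ⊆ j • colMultiples H := by
  have hS : colMultiples H ⊆ colMultiples H + colMultiples H := by
    rintro _ ⟨u, hu, c, rfl⟩
    have hmem : (u / 2) • (fun i => H i c) ∈ colMultiples H := ⟨u / 2, div_ne_zero hu h2, c, rfl⟩
    refine Set.mem_add.mpr ⟨_, hmem, _, hmem, ?_⟩
    rw [← add_smul, ← two_mul, mul_div_cancel₀ _ h2]
  induction j, hmj using Nat.le_induction with
  | base => rfl
  | succ j hmj ih =>
    obtain ⟨i, rfl⟩ := Nat.exists_eq_succ_of_ne_zero (n := j) (by omega)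
    refine ih.trans ?_
    rw [Nat.succ_eq_add_one, succ_nsmul _ (i + 1), succ_nsmul _ i, add_assoc]
    exact Set.add_subset_add_left hS

lemma mulVec_mem_nsmul_colMultiples [DecidableEq F] (h2 : (2 : F) ≠ 0) {j : ℕ} {x : Fin n → F}
    (hx : H.mulVec x ≠ 0) (hxj : hammingNorm x ≤ j) : H.mulVec x ∈ j • colMultiples H := by
  have hx0 : hammingNorm x ≠ 0 := fun h => hx (by simp [hammingNorm_eq_zero.mp h])
  refine nsmul_colMultiples_subset H h2 hx0 hxj ?_
  have hsum : H.mulVec x = ∑ c with x c ≠ 0, x c • (fun i => H i c : Fin r → F) := by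
    rw [Finset.sum_filter_of_ne fun c _ h => left_ne_zero_of_smul h]
    ext i
    simp [Matrix.mulVec, dotProduct, mul_comm]
  rw [hsum, hammingNorm, ← Finset.sum_const]
  exact Set.finsetSum_mem_finsetSum _ _ _ fun c hc => ⟨x c, (Finset.mem_filter.mp hc).2, c, rfl⟩

lemma mulVec_surjective_of_linearIndependent_rows
    (hH : LinearIndependent F (fun i => H i)) : Function.Surjective H.mulVec := by
  have hrank : H.rank = r := by simpa using hH.rank_matrix
  have : LinearMap.range H.mulVecLin = ⊤ :=
    Submodule.eq_top_of_finrank_eq (by simpa [Matrix.rank] using hrank)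
  exact LinearMap.range_eq_top.mp this

lemma exists_codeword_hammingDist_le_iff [DecidableEq F] (v : Fin n → F) (j : ℕ) :
    (∃ c ∈ {x : Fin n → F | H.mulVec x = 0}, hammingDist v c ≤ j) ↔
      ∃ x, H.mulVec x = H.mulVec v ∧ hammingNorm x ≤ j := by
  constructor
  · rintro ⟨c, hc, hd⟩
    rw [Set.mem_ofPred_eq] at hc
    exact ⟨v - c, by rw [Matrix.mulVec_sub, hc, sub_zero], by
      rwa [hammingDist_comm, hammingDist_eq_hammingNorm, neg_add_eq_sub] at hd⟩
  · rintro ⟨x, hx, hj⟩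
    exact ⟨v - x, by simp [Matrix.mulVec_sub, hx], by
      rwa [hammingDist_comm, hammingDist_eq_hammingNorm, neg_add_eq_sub, sub_sub_cancel]⟩

end Syndrome

/-- for an odd prime `q`, a linear `[n,k]_q` code `C` with parity check matrix
`H`, and a maximal family `e₁, …, e_θ` (with `θ = (q^{n-k}-1)/(q-1)`) of pairwise
non-proportional nonzero vectors of `(ZMod q)^{n-k}`, the covering radius of `C` is the
least natural `j` such that the Vilenkin–Chrestenson transform of `ĥ^j` is nonzero at every
`e_i`. -/
theorem coveringRadius_eq_least_vcTransform_pow_ne_zero_on_representatives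
    (q : ℕ) [Fact q.Prime] (hodd : Odd q) (ξ : ℂ) (hξ : IsPrimitiveRoot ξ q)
    (n k : ℕ) (hkn : k ≤ n)
    (H : Matrix (Fin (n - k)) (Fin n) (ZMod q))
    (hH : LinearIndependent (ZMod q) (fun i => H i))
    (θ : ℕ) (hθ : θ = (q ^ (n - k) - 1) / (q - 1))
    (e : Fin θ → (Fin (n - k) → ZMod q))
    (he0 : ∀ i, e i ≠ 0)
    (heprop : ∀ i j : Fin θ, i ≠ j → ∀ u : ZMod q, e i ≠ u • e j)
    (hemax : ∀ y : Fin (n - k) → ZMod q, y ≠ 0 →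
      ∃ i : Fin θ, ∃ u : ZMod q, u ≠ 0 ∧ y = u • e i) :
    IsLeast {j : ℕ | ∀ i : Fin θ,
        vcTransform q (n - k) ξ ((vcTransform q (n - k) ξ (colIndicator H)) ^ j) (e i) ≠ 0}
      (coveringRadius {x : Fin n → ZMod q | H.mulVec x = 0}) := by
  have h2 : (2 : ZMod q) ≠ 0 := by
    have : ringChar (ZMod q) ≠ 2 := by
      rw [ZMod.ringChar_zmod_n]
      rintro rfl
      exact absurd hodd (by decide)
    exact Ring.two_ne_zero this
  have hmem (j : ℕ) (i : Fin θ) :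
      vcTransform q (n - k) ξ ((vcTransform q (n - k) ξ (colIndicator H)) ^ j) (e i) ≠ 0 ↔
        -e i ∈ j • colMultiples H :=
    vcTransform_vcTransform_pow_ne_zero_iff q (n - k) hξ (colMultiples H) j (e i)
  simp only [hmem]
  have hcov : ∀ v : Fin n → ZMod q, ∃ c ∈ {x : Fin n → ZMod q | H.mulVec x = 0},
      hammingDist v c ≤ coveringRadius {x : Fin n → ZMod q | H.mulVec x = 0} := by
    refine Nat.sInf_mem (s := {s : ℕ | ∀ v : Fin n → ZMod q,
      ∃ c ∈ {x : Fin n → ZMod q | H.mulVec x = 0}, hammingDist v c ≤ s}) ⟨n, fun v => ?_⟩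
    exact ⟨0, by simp, by simpa using hammingDist_le_card_fintype (x := v) (y := 0)⟩
  constructor
  · intro i
    obtain ⟨v, hv⟩ := mulVec_surjective_of_linearIndependent_rows H hH (-e i)
    obtain ⟨x, hx, hxj⟩ := (exists_codeword_hammingDist_le_iff H v _).mp (hcov v)
    rw [← hv, ← hx]
    exact mulVec_mem_nsmul_colMultiples H h2 (by simp [hx, hv, he0 i]) hxj
  · intro j hj
    refine Nat.sInf_le fun v => (exists_codeword_hammingDist_le_iff H v j).mpr ?_
    by_cases hv : H.mulVec v = 0
    · exact ⟨0, by simp [hv], by simp⟩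
    · obtain ⟨i, u, hu, hi⟩ := hemax _ hv
      obtain ⟨x, hx, hxj⟩ := exists_mulVec_eq_of_mem_nsmul_colMultiples H (hj i)
      refine ⟨(-u) • x, by rw [Matrix.mulVec_smul, hx, hi, smul_neg, neg_smul, neg_neg], ?_⟩
      exact hammingNorm_smul_le_hammingNorm.trans hxj
end

section
/- Let q be an odd prime and let C be a linear [n,k]_q code with parity check matrix H, with h = h_H the indicator function of the columns of Ĥ and ĥ its Vilenkin–Chrestenson transform. For a nonzero vector y ∈ (ZMod q)^{n−k} and an integer j ≥ 2, the minimum Hamming weight among vectors w ∈ (ZMod q)^n with H·wᵀ = y (i.e., the weight of the coset leader of the coset with syndrome y) equals j if and only if the Vilenkin–Chrestenson transform of ĥ^j at y is nonzero while the Vilenkin–Chrestenson transform of ĥ^{j−1} at y is zero. -/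
open Classical

section Transform

variable {q s : ℕ} [Fact q.Prime] {ξ : ℂ}

theorem vcTransform_eq_sum_zmodChar (hξ : IsPrimitiveRoot ξ q) (h : (Fin s → ZMod q) → ℂ)
    (ω : Fin s → ZMod q) :
    vcTransform q s ξ h ω = ∑ x, h x * AddChar.zmodChar q hξ.pow_eq_one (ω ⬝ᵥ x) := by
  simp only [vcTransform, AddChar.zmodChar_apply, dotProduct]

theorem sum_zmodChar_dotProduct (hξ : IsPrimitiveRoot ξ q) (z : Fin s → ZMod q) :
    ∑ ω : Fin s → ZMod q, AddChar.zmodChar q hξ.pow_eq_one (ω ⬝ᵥ z) =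
      if z = 0 then (q : ℂ) ^ s else 0 := by
  split_ifs with hz
  · simp [hz, ZMod.card]
  · let χ : AddChar (Fin s → ZMod q) ℂ :=
      (AddChar.zmodChar q hξ.pow_eq_one).compAddMonoidHom
        (AddMonoidHom.mk' (fun ω : Fin s → ZMod q => ω ⬝ᵥ z) fun a b => add_dotProduct a b z)
    have hχ : χ ≠ 0 := by
      obtain ⟨i, hi⟩ := Function.ne_iff.mp hz
      intro h
      have h1 := DFunLike.congr_fun h (Pi.single i (z i)⁻¹)
      have h2 : AddChar.zmodChar q hξ.pow_eq_one (1 : ZMod q) = 1 := by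
        simpa [χ, inv_mul_cancel₀ hi] using h1
      have hp := AddChar.zmodChar_primitive_of_primitive_root q hξ
      exact one_ne_zero ((hp.zmod_char_eq_one_iff q 1).mp h2)
    exact AddChar.sum_eq_zero_iff_ne_zero.mpr hχ

theorem vcTransform_vcTransform (hξ : IsPrimitiveRoot ξ q) (f : (Fin s → ZMod q) → ℂ)
    (y : Fin s → ZMod q) :
    vcTransform q s ξ (vcTransform q s ξ f) y = (q : ℂ) ^ s * f (-y) := by
  simp only [vcTransform_eq_sum_zmodChar hξ, Finset.sum_mul]
  rw [Finset.sum_comm]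
  have h : ∀ x ω : Fin s → ZMod q,
      f x * AddChar.zmodChar q hξ.pow_eq_one (ω ⬝ᵥ x) *
        AddChar.zmodChar q hξ.pow_eq_one (y ⬝ᵥ ω) =
      f x * AddChar.zmodChar q hξ.pow_eq_one (ω ⬝ᵥ (x + y)) := fun x ω => by
    rw [dotProduct_add, AddChar.map_add_eq_mul, dotProduct_comm y ω, mul_assoc]
  simp only [h, ← Finset.mul_sum, sum_zmodChar_dotProduct hξ, add_eq_zero_iff_eq_neg]
  simp [mul_comm]

theorem vcTransform_convolution (hξ : IsPrimitiveRoot ξ q) (f g : (Fin s → ZMod q) → ℂ) :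
    vcTransform q s ξ (fun y => ∑ x, f x * g (y - x)) =
      vcTransform q s ξ f * vcTransform q s ξ g := by
  funext ω
  simp only [Pi.mul_apply, vcTransform_eq_sum_zmodChar hξ, Finset.sum_mul]
  rw [Finset.sum_comm]
  refine Finset.sum_congr rfl fun x _ => ?_
  rw [Finset.mul_sum, ← Equiv.sum_comp (Equiv.addRight x)]
  refine Finset.sum_congr rfl fun z _ => ?_
  simp only [Equiv.coe_addRight, add_sub_cancel_right, dotProduct_add, AddChar.map_add_eq_mul]
  ring

end Transform

section Sums

variable {r n : ℕ} {F : Type*} [Field F]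

/-- `y` is a nonzero scalar multiple of a column of `H`. -/
def IsColMultiple (H : Matrix (Fin r) (Fin n) F) (y : Fin r → F) : Prop :=
  ∃ u : F, u ≠ 0 ∧ ∃ j : Fin n, y = u • (fun i => H i j)

theorem colIndicator_eq_ite (H : Matrix (Fin r) (Fin n) F) (y : Fin r → F) :
    colIndicator H y = if IsColMultiple H y then 1 else 0 := rfl

/-- The number of ways of writing `y` as an ordered sum of `j` nonzero multiples of columns
of `H`. -/
noncomputable def colSumCount [Fintype F] (H : Matrix (Fin r) (Fin n) F) :
    ℕ → (Fin r → F) → ℕ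
  | 0, y => if y = 0 then 1 else 0
  | j + 1, y => ∑ x, (if IsColMultiple H x then 1 else 0) * colSumCount H j (y - x)

theorem IsColMultiple.smul {H : Matrix (Fin r) (Fin n) F} {x : Fin r → F}
    (hx : IsColMultiple H x) {a : F} (ha : a ≠ 0) : IsColMultiple H (a • x) := by
  obtain ⟨u, hu, i, rfl⟩ := hx
  exact ⟨a * u, mul_ne_zero ha hu, i, smul_smul _ _ _⟩

variable [Fintype F] (H : Matrix (Fin r) (Fin n) F)

theorem colSumCount_succ_ne_zero_iff (j : ℕ) (y : Fin r → F) :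
    colSumCount H (j + 1) y ≠ 0 ↔ ∃ x, IsColMultiple H x ∧ colSumCount H j (y - x) ≠ 0 := by
  simp [colSumCount, Finset.sum_eq_zero_iff]

theorem colSumCount_succ_ne_zero (h2 : (2 : F) ≠ 0) {j : ℕ} (hj : 1 ≤ j) {y : Fin r → F}
    (hy : colSumCount H j y ≠ 0) : colSumCount H (j + 1) y ≠ 0 := by
  obtain ⟨j, rfl⟩ := Nat.exists_eq_add_of_le' hj
  obtain ⟨x, hx, hxy⟩ := (colSumCount_succ_ne_zero_iff H j y).mp hy
  have hhalf := hx.smul (inv_ne_zero h2)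
  refine (colSumCount_succ_ne_zero_iff H _ _).mpr ⟨_, hhalf,
    (colSumCount_succ_ne_zero_iff H _ _).mpr ⟨_, hhalf, ?_⟩⟩
  convert hxy using 2
  rw [sub_sub, ← add_smul]
  rw [show (2 : F)⁻¹ + 2⁻¹ = 1 by field_simp; norm_num, one_smul]

variable [DecidableEq F]

theorem exists_hammingNorm_le_of_colSumCount_ne_zero (j : ℕ) (y : Fin r → F)
    (hy : colSumCount H j y ≠ 0) : ∃ w, H.mulVec w = y ∧ hammingNorm w ≤ j := by
  induction j generalizing y with
  | zero =>
    refine ⟨0, ?_, by simp⟩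
    have : y = 0 := by simpa [colSumCount] using hy
    simp [this]
  | succ j ih =>
    obtain ⟨x, ⟨u, -, i, rfl⟩, hx⟩ := (colSumCount_succ_ne_zero_iff H j y).mp hy
    obtain ⟨w, hw, hwj⟩ := ih _ hx
    refine ⟨w + Pi.single i u, ?_, ?_⟩
    · rw [Matrix.mulVec_add, hw, Matrix.mulVec_single]
      ext l
      simp
    · have hsub : ({l | (w + Pi.single i u : Fin n → F) l ≠ 0} : Finset (Fin n)) ⊆
          insert i ({l | w l ≠ 0} : Finset (Fin n)) := by
        intro l hl
        by_cases hli : l = i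
        · simp [hli]
        · simpa [hli] using hl
      exact (Finset.card_le_card hsub).trans
        ((Finset.card_insert_le _ _).trans (Nat.succ_le_succ hwj))

theorem colSumCount_hammingNorm_ne_zero (w : Fin n → F) :
    colSumCount H (hammingNorm w) (H.mulVec w) ≠ 0 := by
  generalize hd : hammingNorm w = d
  induction d generalizing w with
  | zero =>
    have : w = 0 := hammingNorm_eq_zero.mp hd
    simp [this, colSumCount]
  | succ d ih =>
    have hw : w ≠ 0 := by
      rintro rfl
      simp at hd
    obtain ⟨i, hi⟩ := Function.ne_iff.mp hw
    have hsupp : ({l | (w - Pi.single i (w i) : Fin n → F) l ≠ 0} : Finset (Fin n)) =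
        ({l | w l ≠ 0} : Finset (Fin n)).erase i := by
      ext l
      by_cases hli : l = i
      · subst hli; simp
      · simp [hli]
    have hnorm : hammingNorm (w - Pi.single i (w i)) = d := by
      unfold hammingNorm at hd ⊢
      rw [hsupp, Finset.card_erase_of_mem (by simpa using hi), hd, Nat.add_sub_cancel]
    refine (colSumCount_succ_ne_zero_iff H d _).mpr ⟨w i • (fun l => H l i),
      ⟨w i, hi, i, rfl⟩, ?_⟩
    convert ih _ hnorm using 2
    rw [Matrix.mulVec_sub, Matrix.mulVec_single]
    ext l
    simp

theorem colSumCount_ne_zero_iff (h2 : (2 : F) ≠ 0) (j : ℕ) {y : Fin r → F} (hy : y ≠ 0) :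
    colSumCount H j y ≠ 0 ↔ ∃ w, H.mulVec w = y ∧ hammingNorm w ≤ j := by
  refine ⟨exists_hammingNorm_le_of_colSumCount_ne_zero H j y, ?_⟩
  rintro ⟨w, rfl, hwj⟩
  have hw : 1 ≤ hammingNorm w := by
    refine Nat.one_le_iff_ne_zero.mpr fun h => hy ?_
    rw [hammingNorm_eq_zero.mp h, Matrix.mulVec_zero]
  induction j, hwj using Nat.le_induction with
  | base => exact colSumCount_hammingNorm_ne_zero H w
  | succ j hj ih => exact colSumCount_succ_ne_zero H h2 (hw.trans hj) ih

end Sums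

section TransformPow

variable {q r n : ℕ} [Fact q.Prime] {ξ : ℂ}

theorem vcTransform_colSumCount (hξ : IsPrimitiveRoot ξ q)
    (H : Matrix (Fin r) (Fin n) (ZMod q)) (j : ℕ) :
    vcTransform q r ξ (fun y => (colSumCount H j y : ℂ)) =
      vcTransform q r ξ (colIndicator H) ^ j := by
  induction j with
  | zero =>
    funext ω
    simp [vcTransform_eq_sum_zmodChar hξ, colSumCount]
  | succ j ih =>
    rw [pow_succ', ← ih, ← vcTransform_convolution hξ]
    congr 1
    funext y
    simp only [colSumCount, colIndicator_eq_ite, Nat.cast_sum, Nat.cast_mul, Nat.cast_ite,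
      Nat.cast_one, Nat.cast_zero]

theorem vcTransform_pow_ne_zero_iff (hodd : Odd q) (hξ : IsPrimitiveRoot ξ q)
    (H : Matrix (Fin r) (Fin n) (ZMod q)) {y : Fin r → ZMod q} (hy : y ≠ 0) (j : ℕ) :
    vcTransform q r ξ (vcTransform q r ξ (colIndicator H) ^ j) y ≠ 0 ↔
      ∃ w, H.mulVec w = y ∧ hammingNorm w ≤ j := by
  have h2 : (2 : ZMod q) ≠ 0 := by
    refine Ring.two_ne_zero ?_
    rw [ZMod.ringChar_zmod_n]
    rintro rfl
    exact absurd hodd (by decide)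
  have hq : (q : ℂ) ^ r ≠ 0 := pow_ne_zero _ (Nat.cast_ne_zero.mpr (NeZero.ne q))
  rw [← vcTransform_colSumCount hξ, vcTransform_vcTransform hξ, mul_ne_zero_iff_left hq,
    Nat.cast_ne_zero, colSumCount_ne_zero_iff H h2 j (neg_ne_zero.mpr hy)]
  have hneg : ∀ w : Fin n → ZMod q, hammingNorm (-w) = hammingNorm w := fun w => by
    simp [hammingNorm]
  constructor
  · rintro ⟨w, hw, hwj⟩
    exact ⟨-w, by rw [Matrix.mulVec_neg, hw, neg_neg], (hneg w).trans_le hwj⟩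
  · rintro ⟨w, hw, hwj⟩
    exact ⟨-w, by rw [Matrix.mulVec_neg, hw], (hneg w).trans_le hwj⟩

end TransformPow

/-- for an odd prime `q`, a parity check matrix `H` of a linear `[n,k]_q`
code, a nonzero syndrome `y` and an integer `j ≥ 2`, the weight of the coset leader of the
coset with syndrome `y` (the minimum Hamming weight of a `w` with `H·wᵀ = y`) equals `j`
iff the Vilenkin–Chrestenson transform of `ĥ^j` is nonzero at `y` while that of `ĥ^{j-1}`
is zero at `y`. -/
theorem cosetLeaderWeight_eq_iff_vcTransform
    (q : ℕ) [Fact q.Prime] (hodd : Odd q) (ξ : ℂ) (hξ : IsPrimitiveRoot ξ q)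
    (n k : ℕ) (hkn : k ≤ n)
    (H : Matrix (Fin (n - k)) (Fin n) (ZMod q))
    (hH : LinearIndependent (ZMod q) (fun i => H i))
    (y : Fin (n - k) → ZMod q) (hy : y ≠ 0) (j : ℕ) (hj : 2 ≤ j) :
    sInf {d : ℕ | ∃ w : Fin n → ZMod q, H.mulVec w = y ∧ hammingNorm w = d} = j ↔
      (vcTransform q (n - k) ξ ((vcTransform q (n - k) ξ (colIndicator H)) ^ j) y ≠ 0 ∧
        vcTransform q (n - k) ξ
          ((vcTransform q (n - k) ξ (colIndicator H)) ^ (j - 1)) y = 0) := by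
  rw [vcTransform_pow_ne_zero_iff hodd hξ H hy, ← not_ne_iff (b := (0 : ℂ)),
    vcTransform_pow_ne_zero_iff hodd hξ H hy]
  constructor
  · intro h
    have hne : {d : ℕ | ∃ w : Fin n → ZMod q, H.mulVec w = y ∧ hammingNorm w = d}.Nonempty :=
      Nat.nonempty_of_pos_sInf (by omega)
    obtain ⟨w, hw, hwd⟩ := Nat.sInf_mem hne
    refine ⟨⟨w, hw, (hwd.trans h).le⟩, ?_⟩
    rintro ⟨v, hv, hvj⟩
    have := Nat.sInf_le (s := {d : ℕ | ∃ w : Fin n → ZMod q, H.mulVec w = y ∧ hammingNorm w = d})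
      ⟨v, hv, rfl⟩
    omega
  · rintro ⟨⟨w, hw, hwj⟩, hmin⟩
    have hmem : hammingNorm w ∈
        {d : ℕ | ∃ w : Fin n → ZMod q, H.mulVec w = y ∧ hammingNorm w = d} :=
      ⟨w, hw, rfl⟩
    refine le_antisymm ((Nat.sInf_le hmem).trans hwj) ?_
    refine le_csInf ⟨_, hmem⟩ ?_
    rintro d ⟨v, hv, rfl⟩
    by_contra hlt
    exact hmin ⟨v, hv, by omega⟩
end
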